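/- If Q({c}) > 0, then ρ(φ) → ∞ as φ ↑ r(∞)c; that is, the critical density ρ* = lim_{φ ↑ r(∞)c} ρ(φ) is infinite. -/

import Mathlib

open MeasureTheory

/-- `R(0) = 1`, `R(k) = r(1)⋯r(k)`. -/
noncomputable def Rfac (r : ℕ → ℝ) (m : ℕ) : ℝ := ∏ i ∈ Finset.range m, r (i + 1)

/-- `Z(ψ) = Σ_{k≥0} ψ^k / R(k)`. -/
noncomputable def Zfun (r : ℕ → ℝ) (ψ : ℝ) : ℝ := ∑' k : ℕ, ψ ^ k / Rfac r k

/-- `M(ψ) = Z(ψ)⁻¹ Σ_{k≥0} k ψ^k / R(k)`, the mean of `μ_ψ`. -/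
noncomputable def Mfun (r : ℕ → ℝ) (ψ : ℝ) : ℝ :=
  (Zfun r ψ)⁻¹ * ∑' k : ℕ, (k : ℝ) * ψ ^ k / Rfac r k

lemma Rfac_pos_aux (r : ℕ → ℝ) (hr1 : 0 < r 1) (hrmono : Monotone r) (k : ℕ) : 0 < Rfac r k :=
  Finset.prod_pos fun i _ => hr1.trans_le (hrmono (by omega))

lemma summ_S (r : ℕ → ℝ) (rinf : ℝ) (hr1 : 0 < r 1) (hrmono : Monotone r)
    (hrlim : Filter.Tendsto r Filter.atTop (nhds rinf)) (ψ : ℝ) (h0 : 0 < ψ) (h1 : ψ < rinf) :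
    Summable (fun k : ℕ => (k : ℝ) * ψ ^ k / Rfac r k) := by
  have hp := Rfac_pos_aux r hr1 hrmono
  have hri : 0 < rinf := h0.trans h1
  refine summable_of_ratio_test_tendsto_lt_one (l := ψ / rinf) ((div_lt_one hri).2 h1) ?_ ?_
  · filter_upwards [Filter.eventually_gt_atTop 0] with k hk
    have := hp k
    positivity
  · have h2 : Filter.Tendsto (fun k : ℕ => ((1:ℝ) + 1 / (k:ℝ)) * (ψ / r (k+1))) Filter.atTop
        (nhds ((1 + 0) * (ψ / rinf))) := by
      refine Filter.Tendsto.mul (tendsto_const_nhds.add tendsto_one_div_atTop_nhds_zero_nat) ?_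
      exact tendsto_const_nhds.div ((Filter.tendsto_add_atTop_iff_nat 1).2 hrlim) hri.ne'
    rw [add_zero, one_mul] at h2
    refine h2.congr' ?_
    filter_upwards [Filter.eventually_gt_atTop 0] with k hk
    have a1 := hp k
    have a2 : 0 < r (k+1) := hr1.trans_le (hrmono (by omega))
    have a3 : Rfac r (k+1) = Rfac r k * r (k+1) := by simp [Rfac, Finset.prod_range_succ]
    have hk' : (0:ℝ) < k := by exact_mod_cast hk
    rw [Real.norm_of_nonneg (by have := hp (k+1); positivity), Real.norm_of_nonneg (by positivity), a3]
    push_cast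
    field_simp
    ring

lemma summ_Z (r : ℕ → ℝ) (rinf : ℝ) (hr1 : 0 < r 1) (hrmono : Monotone r)
    (hrlim : Filter.Tendsto r Filter.atTop (nhds rinf)) (ψ : ℝ) (h0 : 0 < ψ) (h1 : ψ < rinf) :
    Summable (fun k : ℕ => ψ ^ k / Rfac r k) := by
  have hp := Rfac_pos_aux r hr1 hrmono
  rw [← summable_nat_add_iff 1]
  refine Summable.of_nonneg_of_le (fun k => ?_) (fun k => ?_)
    ((summable_nat_add_iff 1).2 (summ_S r rinf hr1 hrmono hrlim ψ h0 h1))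
  · have := hp (k+1)
    positivity
  · have := hp (k+1)
    rw [mul_div_assoc]
    refine le_mul_of_one_le_left (by positivity) ?_
    push_cast
    linarith [(Nat.cast_nonneg k : (0:ℝ) ≤ k)]

lemma Z_pos (r : ℕ → ℝ) (rinf : ℝ) (hr1 : 0 < r 1) (hrmono : Monotone r)
    (hrlim : Filter.Tendsto r Filter.atTop (nhds rinf)) (ψ : ℝ) (h0 : 0 < ψ) (h1 : ψ < rinf) :
    0 < Zfun r ψ := by
  have hp := Rfac_pos_aux r hr1 hrmono
  refine (summ_Z r rinf hr1 hrmono hrlim ψ h0 h1).tsum_pos (fun k => ?_) 0 ?_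
  · have := hp k
    positivity
  · have := hp 0
    positivity

lemma M_lower (r : ℕ → ℝ) (rinf : ℝ) (hr1 : 0 < r 1) (hrmono : Monotone r)
    (hrlim : Filter.Tendsto r Filter.atTop (nhds rinf)) (ψ : ℝ) (h0 : 0 < ψ) (h1 : ψ < rinf) :
    ψ / (rinf - ψ) ≤ Mfun r ψ := by
  have hp := Rfac_pos_aux r hr1 hrmono
  have hS := summ_S r rinf hr1 hrmono hrlim ψ h0 h1
  have hZ := summ_Z r rinf hr1 hrmono hrlim ψ h0 h1
  have hZp := Z_pos r rinf hr1 hrmono hrlim ψ h0 h1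
  have hri : 0 < rinf := h0.trans h1
  unfold Mfun
  set S := ∑' k : ℕ, (k : ℝ) * ψ ^ k / Rfac r k with hSdef
  have e1 : S = ∑' k : ℕ, ((k+1 : ℕ) : ℝ) * ψ ^ (k+1) / Rfac r (k+1) := by
    rw [hSdef, hS.tsum_eq_zero_add]; simp
  have e2 : ψ / rinf * (S + Zfun r ψ)
      = ∑' k : ℕ, ψ / rinf * ((k : ℝ) * ψ ^ k / Rfac r k + ψ ^ k / Rfac r k) := by
    rw [tsum_mul_left, hS.tsum_add hZ]; rfl
  have hS' : Summable (fun k : ℕ => ((k+1 : ℕ) : ℝ) * ψ ^ (k+1) / Rfac r (k+1)) :=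
    (summable_nat_add_iff (f := fun k : ℕ => (k : ℝ) * ψ ^ k / Rfac r k) 1).2 hS
  have e3 : ψ / rinf * (S + Zfun r ψ) ≤ S := by
    rw [e2]
    conv_rhs => rw [e1]
    refine Summable.tsum_le_tsum (fun k => ?_) ((hS.add hZ).mul_left _)
      hS'
    have a1 := hp k
    have a2 : 0 < r (k+1) := hr1.trans_le (hrmono (by omega))
    have a3 : Rfac r (k+1) = Rfac r k * r (k+1) := by simp [Rfac, Finset.prod_range_succ]
    have a4 : r (k+1) ≤ rinf := hrmono.ge_of_tendsto hrlim _
    have l : ψ / rinf * ((k : ℝ) * ψ ^ k / Rfac r k + ψ ^ k / Rfac r k)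
        = ((k+1:ℝ) * ψ ^ (k+1) / Rfac r k) / rinf := by field_simp; ring
    have l' : ((k+1 : ℕ) : ℝ) * ψ ^ (k+1) / Rfac r (k+1)
        = ((k+1:ℝ) * ψ ^ (k+1) / Rfac r k) / r (k+1) := by rw [a3]; push_cast; field_simp
    rw [l, l']
    gcongr
  rw [div_mul_eq_mul_div, div_le_iff₀ hri] at e3
  rw [inv_mul_eq_div, div_le_div_iff₀ (by linarith) hZp]
  nlinarith

lemma M_cont (r : ℕ → ℝ) (rinf : ℝ) (hr1 : 0 < r 1) (hrmono : Monotone r)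
    (hrlim : Filter.Tendsto r Filter.atTop (nhds rinf)) (ψ : ℝ) (h0 : 0 < ψ) (h1 : ψ < rinf) :
    ContinuousOn (Mfun r) (Set.Ioc 0 ψ) := by
  have hp := Rfac_pos_aux r hr1 hrmono
  unfold Mfun
  refine ContinuousOn.mul (ContinuousOn.inv₀ ?_ fun x hx =>
    (Z_pos r rinf hr1 hrmono hrlim x hx.1 (hx.2.trans_lt h1)).ne') ?_
  · refine continuousOn_tsum (fun k => by fun_prop) (summ_Z r rinf hr1 hrmono hrlim ψ h0 h1) ?_
    intro k x hx
    have := hp k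
    have hx0 := hx.1
    have hx1 := hx.2
    rw [Real.norm_of_nonneg (by positivity)]
    gcongr
  · refine continuousOn_tsum (fun k => by fun_prop) (summ_S r rinf hr1 hrmono hrlim ψ h0 h1) ?_
    intro k x hx
    have := hp k
    have hx0 := hx.1
    have hx1 := hx.2
    rw [Real.norm_of_nonneg (by positivity)]
    gcongr

/-- If `Q({c}) > 0`, then `ρ(φ) = ∫_{[c,1]} M(φ/α) Q(dα) → ∞` as `φ ↑ r(∞)c`;
that is, the critical density `ρ*` is infinite. -/
theorem stmt9
    (r : ℕ → ℝ) (rinf : ℝ)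
    (hr0 : r 0 = 0) (hr1 : 0 < r 1) (hrmono : Monotone r)
    (hrlim : Filter.Tendsto r Filter.atTop (nhds rinf))
    (c : ℝ) (hc : c ∈ Set.Ioc (0:ℝ) 1)
    (Q : Measure ℝ) [IsProbabilityMeasure Q] (hQ : Q (Set.Icc c 1) = 1)
    (hQc : 0 < Q {c})
    (ρ : ℝ → ℝ) (hρ : ∀ φ, ρ φ = ∫ a in Set.Icc c 1, Mfun r (φ / a) ∂Q) :
    Filter.Tendsto ρ (nhdsWithin (rinf * c) (Set.Iio (rinf * c))) Filter.atTop := by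
  obtain ⟨hc0, hc1⟩ := hc
  have hri : 0 < rinf := hr1.trans_le (hrmono.ge_of_tendsto hrlim _)
  have hq : 0 < Q.real {c} := ENNReal.toReal_pos hQc.ne' (measure_ne_top _ _)
  have key : ∀ φ, 0 < φ → φ < rinf * c → Q.real {c} * (φ / c / (rinf - φ / c)) ≤ ρ φ := by
    intro φ hφ0 hφ1
    have hψ0 : 0 < φ / c := by positivity
    have hψ1 : φ / c < rinf := (div_lt_iff₀ hc0).2 hφ1
    have hmaps : Set.MapsTo (fun a => φ / a) (Set.Icc c 1) (Set.Ioc 0 (φ / c)) := by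
      intro a ha
      have ha0 : 0 < a := hc0.trans_le ha.1
      have ha1 := ha.1
      refine ⟨by positivity, ?_⟩
      show φ / a ≤ φ / c
      gcongr
    have hcont : ContinuousOn (fun a => Mfun r (φ / a)) (Set.Icc c 1) := by
      refine (M_cont r rinf hr1 hrmono hrlim _ hψ0 hψ1).comp (f := fun a => φ / a) ?_ hmaps
      exact continuousOn_const.div continuousOn_id fun a ha => (hc0.trans_le ha.1).ne'
    have hint : IntegrableOn (fun a => Mfun r (φ / a)) (Set.Icc c 1) Q :=
      hcont.integrableOn_compact isCompact_Icc
    rw [hρ]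
    calc Q.real {c} * (φ / c / (rinf - φ / c)) ≤ Q.real {c} * Mfun r (φ / c) := by
          gcongr
          exact M_lower r rinf hr1 hrmono hrlim _ hψ0 hψ1
      _ = ∫ a in {c}, Mfun r (φ / a) ∂Q := by simp [Measure.real]
      _ ≤ _ := by
          refine setIntegral_mono_set hint ?_ ?_
          · refine (ae_restrict_iff' measurableSet_Icc).2 (Filter.Eventually.of_forall ?_)
            intro a ha
            have hm := hmaps ha
            have hm1 : φ / a < rinf := hm.2.trans_lt hψ1
            refine le_trans ?_ (M_lower r rinf hr1 hrmono hrlim _ hm.1 hm1)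
            exact div_nonneg hm.1.le (by linarith)
          · exact Filter.Eventually.of_forall
              (Set.singleton_subset_iff.2 (Set.left_mem_Icc.2 hc1))
  have hpos : 0 < rinf * c := by positivity
  refine Filter.tendsto_atTop_mono' _ (f₁ := fun φ => Q.real {c} * (φ / c / (rinf - φ / c))) ?_ ?_
  · filter_upwards [self_mem_nhdsWithin, nhdsWithin_le_nhds (lt_mem_nhds hpos)] with φ h1 h2
    exact key φ h2 h1
  · refine Filter.Tendsto.const_mul_atTop hq ?_
    simp only [div_eq_mul_inv _ (rinf - _)]
    have t : Filter.Tendsto (fun φ : ℝ => φ / c) (nhds (rinf * c)) (nhds rinf) := by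
      have : ContinuousAt (fun φ : ℝ => φ / c) (rinf * c) := by fun_prop
      have h := this.tendsto
      simpa [hc0.ne'] using h
    refine Filter.Tendsto.pos_mul_atTop hri (t.mono_left nhdsWithin_le_nhds) ?_
    refine Filter.Tendsto.inv_tendsto_nhdsGT_zero ?_
    refine tendsto_nhdsWithin_iff.2 ⟨?_, ?_⟩
    · have := (tendsto_const_nhds (x := rinf)).sub t
      rw [sub_self] at this
      exact this.mono_left nhdsWithin_le_nhds
    · filter_upwards [self_mem_nhdsWithin] with φ h1
      exact sub_pos.2 ((div_lt_iff₀ hc0).2 h1)
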